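/- arXiv:2507.21784 — 2 statements merged into one kernel-verified Lean document; each statement's English description precedes it below -/
import Mathlib

section
/- Let $G=(V,E)$ be a finite simple graph with $|V| = n \ge 2$, let $\tau \ge 1$ and $\varepsilon_\mathcal{R} \in (0,1)$, and let $v_1,\dots,v_q$ be vertices sampled independently and uniformly at random from $V$ with $q \ge \frac{c\, n \ln n}{\tau\, \varepsilon_\mathcal{R}^2}$ for a constant $c > 0$. For each degree threshold $d$, define the estimate $\widehat{C}(d) = \frac{n}{q}\,\big|\{i \in [q] : \deg(v_i) \ge d\}\big|$. Then with probability at least $1 - 2n\exp\big(-\tfrac{q\,\tau\,\varepsilon_\mathcal{R}^2}{3n}\big)$, simultaneously for every degree $d$ with $C(d) \ge \tau$, it holds that $(1-\varepsilon_\mathcal{R})\,C(d) \le \widehat{C}(d) \le (1+\varepsilon_\mathcal{R})\,C(d)$. -/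
open MeasureTheory ProbabilityTheory

/-- The complementary cumulative degree histogram (ccdh) of a graph:
`C(d) = |{v ∈ V : deg(v) ≥ d}|`. -/
noncomputable def ccdh {V : Type*} [Fintype V] (G : SimpleGraph V) [DecidableRel G.Adj] (d : ℕ) : ℕ :=
  {v : V | d ≤ G.degree v}.ncard

lemma MeasureTheory.nullMeasurableSet_of_measure_add_measure_compl_le
    {Ω : Type*} [MeasurableSpace Ω] {μ : Measure Ω} [IsFiniteMeasure μ] {s : Set Ω}
    (h : μ s + μ sᶜ ≤ μ Set.univ) : NullMeasurableSet s μ := by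
  have hm : MeasurableSet (toMeasurable μ sᶜ) := measurableSet_toMeasurable _ _
  have hsub : (toMeasurable μ sᶜ)ᶜ ⊆ s :=
    Set.compl_subset_comm.1 (subset_toMeasurable μ sᶜ)
  have hle : μ s ≤ μ (toMeasurable μ sᶜ)ᶜ := by
    rw [measure_compl hm (measure_ne_top _ _), measure_toMeasurable]
    exact ENNReal.le_sub_of_add_le_right (measure_ne_top _ _) h
  exact hm.compl.nullMeasurableSet.congr
    (ae_eq_of_subset_of_measure_ge hsub hle hm.compl.nullMeasurableSet (measure_ne_top _ _))

/-- A map to a finite type is a.e.-measurable as soon as the outer measures of its fibres add up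
to the total mass. -/
lemma MeasureTheory.aemeasurable_of_sum_measure_fiber_le
    {Ω V : Type*} [MeasurableSpace Ω] [Fintype V] [MeasurableSpace V] [DiscreteMeasurableSpace V]
    {μ : Measure Ω} [IsFiniteMeasure μ] {f : Ω → V}
    (h : ∑ w, μ (f ⁻¹' {w}) ≤ μ Set.univ) : AEMeasurable f μ := by
  classical
  have key (s : Finset V) : μ (f ⁻¹' s) ≤ ∑ w ∈ s, μ (f ⁻¹' {w}) := by
    refine (measure_mono ?_).trans (measure_biUnion_finset_le s _)
    intro ω hω
    simpa using hω
  have hnull : NullMeasurable f μ := by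
    intro s _
    refine nullMeasurableSet_of_measure_add_measure_compl_le (le_trans ?_ h)
    rw [← Finset.sum_add_sum_compl s.toFinset]
    refine add_le_add (by simpa using key s.toFinset) ?_
    simpa using key s.toFinsetᶜ
  exact hnull.aemeasurable

lemma ProbabilityTheory.measureReal_preimage_of_uniform
    {Ω V : Type*} [MeasurableSpace Ω] [Fintype V] [MeasurableSpace V] [DiscreteMeasurableSpace V]
    {μ : Measure Ω} {f : Ω → V} (hf : AEMeasurable f μ) {n : ℕ}
    (h : ∀ w, μ (f ⁻¹' {w}) = (n : ENNReal)⁻¹) (s : Set V) :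
    μ.real (f ⁻¹' s) = s.ncard / n := by
  classical
  have hs : μ.map f s = ∑ w ∈ s.toFinset, (n : ENNReal)⁻¹ := by
    rw [← Set.coe_toFinset s, ← sum_measure_singleton]
    simp [Measure.map_apply_of_aemeasurable hf, h]
  rw [Measure.map_apply_of_aemeasurable hf s.toFinite.measurableSet] at hs
  rw [Measure.real, hs, Set.ncard_eq_toFinset_card']
  simp [div_eq_mul_inv]

lemma ProbabilityTheory.mgf_indicator_one
    {Ω : Type*} [MeasurableSpace Ω] {μ : Measure Ω} [IsProbabilityMeasure μ] {s : Set Ω}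
    (hs : NullMeasurableSet s μ) (t : ℝ) :
    mgf (s.indicator 1) μ t = 1 + μ.real s * (Real.exp t - 1) := by
  have h : (fun ω => Real.exp (t * s.indicator (1 : Ω → ℝ) ω)) =
      fun ω => 1 + s.indicator (fun _ => Real.exp t - 1) ω := by
    ext ω
    by_cases hω : ω ∈ s <;> simp [hω]
  rw [mgf, h, integral_add (integrable_const _) ((integrable_const _).indicator₀ hs),
    integral_indicator₀ hs]
  simp

section Chernoff

variable {Ω ι : Type*} [MeasurableSpace Ω] [Fintype ι] {μ : Measure Ω} [IsProbabilityMeasure μ]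
  {A : ι → Set Ω} {p : ℝ}

lemma ProbabilityTheory.integrable_exp_mul_sum_indicator_one
    (hA : ∀ i, NullMeasurableSet (A i) μ) (t : ℝ) :
    Integrable (fun ω => Real.exp (t * (∑ i, (A i).indicator (1 : Ω → ℝ)) ω)) μ := by
  have hm : AEMeasurable (∑ i, (A i).indicator (1 : Ω → ℝ)) μ :=
    Finset.aemeasurable_sum _ fun i _ => aemeasurable_one.indicator₀ (hA i)
  refine Integrable.of_bound (C := Real.exp (|t| * Fintype.card ι))
    (Real.measurable_exp.comp_aemeasurable (hm.const_mul t)).aestronglyMeasurable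
    (Filter.Eventually.of_forall fun ω => ?_)
  rw [Real.norm_eq_abs, Real.abs_exp, Real.exp_le_exp]
  have h0 : 0 ≤ (∑ i, (A i).indicator (1 : Ω → ℝ)) ω := by
    rw [Finset.sum_apply]
    exact Finset.sum_nonneg fun i _ => Set.indicator_nonneg (fun _ _ => zero_le_one) ω
  have h1 : (∑ i, (A i).indicator (1 : Ω → ℝ)) ω ≤ Fintype.card ι := by
    rw [Finset.sum_apply]
    refine (Finset.sum_le_card_nsmul _ _ 1 fun i _ => ?_).trans (by simp)
    exact Set.indicator_le_self' (fun _ _ => zero_le_one) ω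
  gcongr
  exact le_abs_self t

lemma ProbabilityTheory.mgf_sum_indicator_one_le
    (hA : ∀ i, NullMeasurableSet (A i) μ)
    (hindep : iIndepFun (fun i => (A i).indicator (1 : Ω → ℝ)) μ)
    (hp : ∀ i, μ.real (A i) = p) (t : ℝ) :
    mgf (∑ i, (A i).indicator (1 : Ω → ℝ)) μ t ≤
      Real.exp (Fintype.card ι * p * (Real.exp t - 1)) := by
  rw [hindep.mgf_sum₀ fun i => aemeasurable_one.indicator₀ (hA i), mul_assoc, Real.exp_nat_mul,
    ← Finset.card_univ, ← Finset.prod_const]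
  refine Finset.prod_le_prod (fun i _ => mgf_nonneg) fun i _ => ?_
  rw [mgf_indicator_one (hA i), hp i, add_comm]
  exact Real.add_one_le_exp _

/-- Multiplicative **Chernoff bound**, upper tail. -/
lemma ProbabilityTheory.measureReal_sum_indicator_one_ge_le
    (hA : ∀ i, NullMeasurableSet (A i) μ)
    (hindep : iIndepFun (fun i => (A i).indicator (1 : Ω → ℝ)) μ)
    (hp : ∀ i, μ.real (A i) = p) (hp0 : 0 ≤ p) {ε : ℝ} (hε0 : 0 ≤ ε) (hε1 : ε ≤ 1) :
    μ.real {ω | (1 + ε) * (Fintype.card ι * p) ≤ (∑ i, (A i).indicator (1 : Ω → ℝ)) ω} ≤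
      Real.exp (-(Fintype.card ι * p * ε ^ 2 / 3)) := by
  have hlog := Real.le_log_one_add_of_nonneg hε0
  have hlog0 : 0 ≤ Real.log (1 + ε) := Real.log_nonneg (by linarith)
  refine (measure_ge_le_exp_mul_mgf _ hlog0
    (integrable_exp_mul_sum_indicator_one hA _)).trans ?_
  refine (mul_le_mul_of_nonneg_left (mgf_sum_indicator_one_le hA hindep hp _)
    (Real.exp_pos _).le).trans ?_
  rw [← Real.exp_add, Real.exp_le_exp, Real.exp_log (by linarith)]
  have hm : 0 ≤ Fintype.card ι * p := by positivity
  have key : ε + ε ^ 2 / 3 ≤ (1 + ε) * Real.log (1 + ε) := by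
    refine le_trans ?_ (mul_le_mul_of_nonneg_left hlog (by linarith))
    rw [← mul_div_assoc, le_div_iff₀ (by linarith)]
    nlinarith [mul_nonneg (sq_nonneg ε) (sub_nonneg.2 hε1)]
  nlinarith [mul_le_mul_of_nonneg_left key hm]

lemma Real.exp_neg_le_one_sub_add_sq_div_two {t : ℝ} (ht : 0 ≤ t) :
    Real.exp (-t) ≤ 1 - t + t ^ 2 / 2 := by
  have h := Real.quadratic_le_exp_of_nonneg ht
  have hpos : 0 ≤ 1 - t + t ^ 2 / 2 := by nlinarith [sq_nonneg (t - 1)]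
  rw [Real.exp_neg, inv_le_iff_one_le_mul₀ (Real.exp_pos t)]
  nlinarith [mul_le_mul_of_nonneg_left h hpos, sq_nonneg (t ^ 2)]

/-- Multiplicative **Chernoff bound**, lower tail. -/
lemma ProbabilityTheory.measureReal_sum_indicator_one_le_le
    (hA : ∀ i, NullMeasurableSet (A i) μ)
    (hindep : iIndepFun (fun i => (A i).indicator (1 : Ω → ℝ)) μ)
    (hp : ∀ i, μ.real (A i) = p) (hp0 : 0 ≤ p) {ε : ℝ} (hε0 : 0 ≤ ε) :
    μ.real {ω | (∑ i, (A i).indicator (1 : Ω → ℝ)) ω ≤ (1 - ε) * (Fintype.card ι * p)} ≤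
      Real.exp (-(Fintype.card ι * p * ε ^ 2 / 2)) := by
  refine (measure_le_le_exp_mul_mgf _ (neg_nonpos.2 hε0)
    (integrable_exp_mul_sum_indicator_one hA _)).trans ?_
  refine (mul_le_mul_of_nonneg_left (mgf_sum_indicator_one_le hA hindep hp _)
    (Real.exp_pos _).le).trans ?_
  rw [← Real.exp_add, Real.exp_le_exp]
  have hm : 0 ≤ Fintype.card ι * p := by positivity
  nlinarith [mul_le_mul_of_nonneg_left (Real.exp_neg_le_one_sub_add_sq_div_two hε0) hm]

/-- Two-sided multiplicative **Chernoff bound**. -/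
lemma ProbabilityTheory.measureReal_not_sum_indicator_one_mem_Icc_le
    (hA : ∀ i, NullMeasurableSet (A i) μ)
    (hindep : iIndepFun (fun i => (A i).indicator (1 : Ω → ℝ)) μ)
    (hp : ∀ i, μ.real (A i) = p) (hp0 : 0 ≤ p) {ε : ℝ} (hε0 : 0 ≤ ε) (hε1 : ε ≤ 1) :
    μ.real {ω | ¬ ((1 - ε) * (Fintype.card ι * p) ≤ (∑ i, (A i).indicator (1 : Ω → ℝ)) ω ∧
        (∑ i, (A i).indicator (1 : Ω → ℝ)) ω ≤ (1 + ε) * (Fintype.card ι * p))} ≤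
      2 * Real.exp (-(Fintype.card ι * p * ε ^ 2 / 3)) := by
  have hm : 0 ≤ Fintype.card ι * p * ε ^ 2 := by positivity
  have hup := measureReal_sum_indicator_one_ge_le hA hindep hp hp0 hε0 hε1
  have hlow := (measureReal_sum_indicator_one_le_le hA hindep hp hp0 hε0).trans
    (Real.exp_le_exp.2 (show _ ≤ -(Fintype.card ι * p * ε ^ 2 / 3) by linarith))
  rw [two_mul]
  refine le_trans ?_ ((measureReal_union_le _ _).trans (add_le_add hlow hup))
  refine measureReal_mono fun ω hω => ?_
  rw [Set.mem_ofPred_eq, not_and_or, not_le, not_le] at hω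
  exact hω.imp le_of_lt le_of_lt

end Chernoff

lemma ccdh_eq_zero_of_card_le {V : Type*} [Fintype V] (G : SimpleGraph V) [DecidableRel G.Adj]
    {d : ℕ} (hd : Fintype.card V ≤ d) : ccdh G d = 0 := by
  rw [ccdh, Set.ncard_eq_zero]
  ext w
  simpa using (G.degree_lt_card_verts w).trans_le hd

/-- **Head estimation guarantee.** Sampling `q ≥ c n ln n / (τ εR²)` vertices i.i.d.
uniformly from `V` and setting `Ĉ(d) = (n/q) |{i : deg(vᵢ) ≥ d}|`, with probability at
least `1 - 2n exp(-q τ εR² / (3n))`, simultaneously every degree `d` with `C(d) ≥ τ`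
satisfies `(1-εR) C(d) ≤ Ĉ(d) ≤ (1+εR) C(d)`. -/
theorem ccdh_head_estimation
    {V : Type*} [Fintype V] (G : SimpleGraph V) [DecidableRel G.Adj]
    (n : ℕ) (hn : n = Fintype.card V) (hn2 : 2 ≤ n)
    (τ : ℝ) (hτ : 1 ≤ τ) (εR : ℝ) (hεR0 : 0 < εR) (hεR1 : εR < 1)
    (c : ℝ) (hc : 0 < c)
    {Ω : Type*} [MeasurableSpace Ω] (μ : Measure Ω) [IsProbabilityMeasure μ]
    (q : ℕ) (hq : c * n * Real.log n / (τ * εR ^ 2) ≤ q)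
    (v : Fin q → Ω → V)
    (hindep : iIndepFun (m := fun _ => ⊤) v μ)
    (hunif : ∀ i : Fin q, ∀ w : V, μ {ω | v i ω = w} = (n : ENNReal)⁻¹)
    (Chat : Ω → ℕ → ℝ)
    (hChat : ∀ ω d, Chat ω d = (n / q : ℝ) * ({i : Fin q | d ≤ G.degree (v i ω)}.ncard : ℝ)) :
    1 - 2 * n * Real.exp (-(q * τ * εR ^ 2 / (3 * n))) ≤
      (μ {ω | ∀ d : ℕ, τ ≤ (ccdh G d : ℝ) →
        (1 - εR) * (ccdh G d : ℝ) ≤ Chat ω d ∧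
        Chat ω d ≤ (1 + εR) * (ccdh G d : ℝ)}).toReal := by
  classical
  let _ : MeasurableSpace V := ⊤
  have hn0 : (0 : ℝ) < n := by positivity
  have hlog : 0 < Real.log n := Real.log_pos (by exact_mod_cast hn2)
  have hq0 : (0 : ℝ) < q := lt_of_lt_of_le (by positivity) hq
  have hmeas (i : Fin q) : AEMeasurable (v i) μ := by
    refine aemeasurable_of_sum_measure_fiber_le ?_
    refine (Finset.sum_congr rfl fun w _ => hunif i w).trans_le ?_
    rw [Finset.sum_const, Finset.card_univ, ← hn, nsmul_eq_mul, measure_univ]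
    exact ENNReal.mul_inv_le_one _
  set bad : ℕ → Set Ω := fun d => {ω | ¬ ((1 - εR) * (ccdh G d : ℝ) ≤ Chat ω d ∧
    Chat ω d ≤ (1 + εR) * (ccdh G d : ℝ))} with hbad
  have hbad_le (d : ℕ) (hd : τ ≤ ccdh G d) :
      μ.real (bad d) ≤ 2 * Real.exp (-(q * τ * εR ^ 2 / (3 * n))) := by
    set s : Set V := {w | d ≤ G.degree w}
    have hA (i : Fin q) : NullMeasurableSet (v i ⁻¹' s) μ :=
      (hmeas i).nullMeasurable MeasurableSpace.measurableSet_top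
    have hindep' : iIndepFun (fun i => (v i ⁻¹' s).indicator (1 : Ω → ℝ)) μ :=
      hindep.comp (fun _ => s.indicator 1) fun _ => measurable_from_top
    have hp (i : Fin q) : μ.real (v i ⁻¹' s) = ccdh G d / n :=
      measureReal_preimage_of_uniform (hmeas i) (hunif i) s
    have hcount (ω : Ω) : Chat ω d =
        n / q * (∑ i, (v i ⁻¹' s).indicator (1 : Ω → ℝ)) ω := by
      rw [hChat, Set.ncard_eq_toFinset_card', Finset.sum_apply]
      simp [Set.indicator_apply, s, Finset.sum_boole]
    have h := measureReal_not_sum_indicator_one_mem_Icc_le hA hindep' hp (by positivity)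
      hεR0.le hεR1.le
    rw [Fintype.card_fin] at h
    have hset : bad d = {ω | ¬ ((1 - εR) * (q * (ccdh G d / n)) ≤
        (∑ i, (v i ⁻¹' s).indicator (1 : Ω → ℝ)) ω ∧
        (∑ i, (v i ⁻¹' s).indicator (1 : Ω → ℝ)) ω ≤ (1 + εR) * (q * (ccdh G d / n)))} := by
      ext ω
      simp only [hbad, Set.mem_ofPred_eq, hcount]
      generalize (∑ i, (v i ⁻¹' s).indicator (1 : Ω → ℝ)) ω = S
      have e (a : ℝ) : a * (ccdh G d : ℝ) = n / q * (a * (q * (ccdh G d / n))) := by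
        field_simp
      have hnq : (0 : ℝ) < n / q := by positivity
      rw [e, e, mul_le_mul_iff_right₀ hnq, mul_le_mul_iff_right₀ hnq]
    rw [hset]
    refine h.trans ?_
    rw [show (q : ℝ) * (ccdh G d / n) * εR ^ 2 / 3 = q * ccdh G d * εR ^ 2 / (3 * n) by
      field_simp]
    gcongr
  set good : Set Ω := {ω | ∀ d : ℕ, τ ≤ (ccdh G d : ℝ) →
    (1 - εR) * (ccdh G d : ℝ) ≤ Chat ω d ∧ Chat ω d ≤ (1 + εR) * (ccdh G d : ℝ)} with hgood
  set D : Finset ℕ := (Finset.range n).filter fun d => τ ≤ ccdh G d with hD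
  have hcover : Set.univ ⊆ good ∪ ⋃ d ∈ D, bad d := by
    intro ω _
    by_contra hω
    simp only [Set.mem_union, Set.mem_iUnion, not_or, not_exists] at hω
    refine hω.1 fun d hd => ?_
    have hdn : d < n := by
      by_contra! hnd
      rw [ccdh_eq_zero_of_card_le G (hn ▸ hnd)] at hd
      norm_num at hd
      linarith
    exact not_not.1 (hω.2 d (by simp [hD, hdn, hd]))
  have hsum : μ.real (⋃ d ∈ D, bad d) ≤
      2 * n * Real.exp (-(q * τ * εR ^ 2 / (3 * n))) := by
    refine (measureReal_biUnion_finset_le D bad).trans ?_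
    refine (Finset.sum_le_card_nsmul _ _ _ fun d hd =>
      hbad_le d (Finset.mem_filter.1 hd).2).trans ?_
    have hcard : (D.card : ℝ) ≤ n := by
      exact_mod_cast (Finset.card_filter_le _ _).trans_eq (Finset.card_range n)
    rw [nsmul_eq_mul, mul_comm 2 (n : ℝ), mul_assoc (n : ℝ) 2]
    exact mul_le_mul_of_nonneg_right hcard (by positivity)
  have htotal := (measureReal_mono (μ := μ) hcover).trans (measureReal_union_le _ _)
  rw [probReal_univ] at htotal
  change _ ≤ μ.real good
  linarith
end

section
/- Let $G=(V,E)$ be a finite simple graph with $|V| = n \ge 2$ and $|E| = m \ge 1$, let $\tau \ge 1$ and $\varepsilon_\mathcal{D} \in (0,1/2]$, and let $e_1,\dots,e_r$ be edges sampled independently and uniformly at random from $E$ with $r \ge \frac{c\, m \ln n}{\tau\, \varepsilon_\mathcal{D}^2}$ for a sufficiently large constant $c > 0$. For each vertex $v$ define $\widehat{\deg}(v) = \frac{m}{r}\,\big|\{j \in [r] : v \in e_j\}\big|$, and for each threshold $d$ define $\widehat{C}(d) = \big|\{v \in V : \widehat{\deg}(v) \ge d\}\big|$. Then with probability at least $1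 - n^{-c'}$ for a constant $c' > 0$ depending on $c$, simultaneously for every degree $d > \tau$ it holds that $C\big((1+\varepsilon_\mathcal{D})d\big) \le \widehat{C}(d) \le C\big((1-\varepsilon_\mathcal{D})d\big)$. -/
open MeasureTheory ProbabilityTheory

/-- The ccdh of a graph extended to real thresholds:
`C(t) = |{v ∈ V : deg(v) ≥ t}|`. -/
noncomputable def ccdhR {V : Type*} [Fintype V] (G : SimpleGraph V) [DecidableRel G.Adj]
    (t : ℝ) : ℕ :=
  {v : V | t ≤ (G.degree v : ℝ)}.ncard

open Finset in
/-- The moment generating function of the number of hits of `p` among `r` draws from `S`. -/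
theorem sum_exp_mul_card_piFinset {α : Type*} (S : Finset α) (p : α → Prop) [DecidablePred p]
    (r : ℕ) (s : ℝ) :
    ∑ x ∈ Fintype.piFinset (fun _ : Fin r => S), Real.exp (s * #{j | p (x j)}) =
      (#S + #{a ∈ S | p a} * (Real.exp s - 1)) ^ r := by
  have hfactor (x : Fin r → α) :
      Real.exp (s * #{j | p (x j)}) = ∏ j, if p (x j) then Real.exp s else 1 := by
    rw [prod_ite, prod_const_one, mul_one, prod_const, ← Real.exp_nat_mul, mul_comm]
  have hsum : ∑ a ∈ S, (if p a then Real.exp s else 1) =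
      #S + #{a ∈ S | p a} * (Real.exp s - 1) := by
    have hsplit (a : α) : (if p a then Real.exp s else 1) =
        1 + if p a then Real.exp s - 1 else 0 := by split_ifs <;> ring
    simp_rw [hsplit, sum_add_distrib, ← sum_filter, sum_const, nsmul_eq_mul, mul_one]
  simp_rw [hfactor]
  rw [← hsum, ← prod_univ_sum (fun _ : Fin r => S) (fun _ a => if p a then Real.exp s else 1),
    prod_const, card_univ, Fintype.card_fin]

open Finset in
/-- Chernoff bound for counting tuples, for both tails (according to the sign of `s`). -/
theorem card_filter_piFinset_le_exp {α : Type*} (S : Finset α) (hS : S.Nonempty) (p : α → Prop)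
    [DecidablePred p] (r : ℕ) {s : ℝ} (hs : |s| ≤ 1) (a : ℝ) :
    (#{x ∈ Fintype.piFinset (fun _ : Fin r => S) | s * a ≤ s * #{j | p (x j)}} : ℝ) ≤
      (#S : ℝ) ^ r * Real.exp (-(s * a) + r * #{a ∈ S | p a} / #S * (s + s ^ 2)) := by
  have hm : (0 : ℝ) < #S := by exact_mod_cast hS.card_pos
  have hk : (#{a ∈ S | p a} : ℝ) ≤ #S := by exact_mod_cast card_filter_le _ _
  set k : ℝ := ((#{a ∈ S | p a} : ℕ) : ℝ)
  have hk0 : 0 ≤ k := Nat.cast_nonneg _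
  have hexp : Real.exp s - 1 ≤ s + s ^ 2 := by
    have := (abs_le.1 (Real.abs_exp_sub_one_sub_id_le hs)).2
    linarith
  have hbase : #S + k * (Real.exp s - 1) ≤ #S * Real.exp (k / #S * (s + s ^ 2)) := by
    have h1 := Real.add_one_le_exp (k / #S * (s + s ^ 2))
    calc #S + k * (Real.exp s - 1) ≤ #S + k * (s + s ^ 2) := by gcongr
      _ = #S * (k / #S * (s + s ^ 2) + 1) := by field_simp; ring
      _ ≤ _ := by gcongr
  have hbase0 : 0 ≤ #S + k * (Real.exp s - 1) := by nlinarith [Real.exp_pos s]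
  calc (#{x ∈ Fintype.piFinset (fun _ : Fin r => S) | s * a ≤ s * #{j | p (x j)}} : ℝ)
      = ∑ x ∈ Fintype.piFinset (fun _ : Fin r => S) with s * a ≤ s * #{j | p (x j)}, 1 := by simp
    _ ≤ ∑ x ∈ Fintype.piFinset (fun _ : Fin r => S) with s * a ≤ s * #{j | p (x j)},
          Real.exp (-(s * a)) * Real.exp (s * #{j | p (x j)}) := by
        refine sum_le_sum fun x hx => ?_
        rw [← Real.exp_add]
        exact Real.one_le_exp (by linarith [(mem_filter.1 hx).2])
    _ ≤ ∑ x ∈ Fintype.piFinset (fun _ : Fin r => S),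
          Real.exp (-(s * a)) * Real.exp (s * #{j | p (x j)}) :=
        sum_le_sum_of_subset_of_nonneg (filter_subset _ _) fun _ _ _ => by positivity
    _ = Real.exp (-(s * a)) * (#S + k * (Real.exp s - 1)) ^ r := by
        rw [← mul_sum, sum_exp_mul_card_piFinset]
    _ ≤ Real.exp (-(s * a)) * (#S * Real.exp (k / #S * (s + s ^ 2))) ^ r := by gcongr
    _ = _ := by
        rw [mul_pow, ← Real.exp_nat_mul, Real.exp_add]
        ring_nf

open Finset in
/-- The law of independent uniform samples is at most the normalized counting measure. No
measurability of the samples is needed. -/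
theorem measure_mem_le_card_mul_of_iIndepFun {α Ω : Type*} [MeasurableSpace Ω] {μ : Measure Ω}
    {S : Finset α} {r : ℕ} {e : Fin r → Ω → α} (hind : iIndepFun (m := fun _ => ⊤) e μ)
    (hunif : ∀ j, ∀ a ∈ S, μ {ω | e j ω = a} = (#S : ENNReal)⁻¹)
    (B : Finset (Fin r → α)) (hB : B ⊆ Fintype.piFinset fun _ => S) :
    μ {ω | (fun j => e j ω) ∈ B} ≤ #B * ((#S : ENNReal) ^ r)⁻¹ := by
  have hcover : {ω | (fun j => e j ω) ∈ B} ⊆ ⋃ x ∈ B, ⋂ j ∈ (univ : Finset (Fin r)),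
      e j ⁻¹' {x j} := by
    intro ω hω
    simp only [Set.mem_iUnion, Set.mem_iInter]
    exact ⟨_, hω, fun _ _ => rfl⟩
  calc μ {ω | (fun j => e j ω) ∈ B}
      ≤ ∑ x ∈ B, μ (⋂ j ∈ (univ : Finset (Fin r)), e j ⁻¹' {x j}) :=
        (measure_mono hcover).trans (measure_biUnion_finset_le _ _)
    _ = ∑ x ∈ B, ((#S : ENNReal) ^ r)⁻¹ := by
        refine sum_congr rfl fun x hx => ?_
        rw [hind.measure_inter_preimage_eq_mul univ (fun _ _ => trivial),
          prod_congr rfl fun j _ => show μ (e j ⁻¹' {x j}) = (#S : ENNReal)⁻¹ from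
            hunif j (x j) (Fintype.mem_piFinset.1 (hB hx) j),
          prod_const, card_univ, Fintype.card_fin, ENNReal.inv_pow]
    _ = _ := by rw [sum_const, nsmul_eq_mul]

open Finset in
/-- Chernoff bound for the number of hits of `p` among independent uniform samples from `S`. -/
theorem measure_mul_le_mul_card_le_exp {α Ω : Type*} [MeasurableSpace Ω] {μ : Measure Ω}
    {S : Finset α} (hS : S.Nonempty) {r : ℕ} {e : Fin r → Ω → α}
    (hind : iIndepFun (m := fun _ => ⊤) e μ) (hmem : ∀ j ω, e j ω ∈ S)
    (hunif : ∀ j, ∀ a ∈ S, μ {ω | e j ω = a} = (#S : ENNReal)⁻¹)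
    (p : α → Prop) [DecidablePred p] {s : ℝ} (hs : |s| ≤ 1) (a : ℝ) :
    μ {ω | s * a ≤ s * #{j | p (e j ω)}} ≤
      ENNReal.ofReal (Real.exp (-(s * a) + r * #{a ∈ S | p a} / #S * (s + s ^ 2))) := by
  have hm : (0 : ℝ) < #S := by exact_mod_cast hS.card_pos
  set B := {x ∈ Fintype.piFinset (fun _ : Fin r => S) | s * a ≤ s * #{j | p (x j)}} with hB
  have hevent : {ω | s * a ≤ s * #{j | p (e j ω)}} = {ω | (fun j => e j ω) ∈ B} := by
    ext ω
    simp [hB, hmem]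
  have hcard := card_filter_piFinset_le_exp S hS p r hs a
  rw [← hB] at hcard
  rw [hevent]
  refine (measure_mem_le_card_mul_of_iIndepFun hind hunif B (filter_subset _ _)).trans ?_
  rw [← div_eq_mul_inv]
  refine ENNReal.div_le_of_le_mul ?_
  have := ENNReal.ofReal_le_ofReal hcard
  rw [mul_comm, ENNReal.ofReal_mul (by positivity), ENNReal.ofReal_pow hm.le,
    ENNReal.ofReal_natCast, ENNReal.ofReal_natCast] at this
  exact this

open Finset in
/-- Upper tail: a hit count with mean at most `(1 - ε) a` rarely reaches `a`. -/
theorem measure_le_card_le_exp {α Ω : Type*} [MeasurableSpace Ω] {μ : Measure Ω}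
    {S : Finset α} (hS : S.Nonempty) {r : ℕ} {e : Fin r → Ω → α}
    (hind : iIndepFun (m := fun _ => ⊤) e μ) (hmem : ∀ j ω, e j ω ∈ S)
    (hunif : ∀ j, ∀ a ∈ S, μ {ω | e j ω = a} = (#S : ENNReal)⁻¹)
    (p : α → Prop) [DecidablePred p] {ε a : ℝ} (hε : 0 < ε) (hε' : ε ≤ 1 / 2) (ha : 0 ≤ a)
    (hmean : r * #{a ∈ S | p a} / #S ≤ (1 - ε) * a) :
    μ {ω | a ≤ #{j | p (e j ω)}} ≤ ENNReal.ofReal (Real.exp (-(ε ^ 2 * a / 6))) := by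
  have hs : |ε / 3| ≤ 1 := by rw [abs_of_pos (by positivity)]; linarith
  refine (measure_mono ?_).trans
    ((measure_mul_le_mul_card_le_exp hS hind hmem hunif p hs a).trans
      (ENNReal.ofReal_le_ofReal (Real.exp_le_exp.2 ?_)))
  · intro ω hω
    rw [Set.mem_ofPred_eq] at hω ⊢
    gcongr
  · have h := mul_le_mul_of_nonneg_right hmean (show 0 ≤ ε / 3 + (ε / 3) ^ 2 by positivity)
    nlinarith [mul_nonneg (sq_nonneg ε) ha, mul_nonneg (pow_nonneg hε.le 3) ha]

open Finset in
/-- Lower tail: a hit count with mean at least `(1 + ε) a` rarely drops to `a`. -/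
theorem measure_card_le_le_exp {α Ω : Type*} [MeasurableSpace Ω] {μ : Measure Ω}
    {S : Finset α} (hS : S.Nonempty) {r : ℕ} {e : Fin r → Ω → α}
    (hind : iIndepFun (m := fun _ => ⊤) e μ) (hmem : ∀ j ω, e j ω ∈ S)
    (hunif : ∀ j, ∀ a ∈ S, μ {ω | e j ω = a} = (#S : ENNReal)⁻¹)
    (p : α → Prop) [DecidablePred p] {ε a : ℝ} (hε : 0 < ε) (hε' : ε ≤ 1 / 2) (ha : 0 ≤ a)
    (hmean : (1 + ε) * a ≤ r * #{a ∈ S | p a} / #S) :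
    μ {ω | (#{j | p (e j ω)} : ℝ) ≤ a} ≤ ENNReal.ofReal (Real.exp (-(ε ^ 2 * a / 6))) := by
  have hs : |-(ε / 3)| ≤ 1 := by rw [abs_neg, abs_of_pos (by positivity)]; linarith
  refine (measure_mono ?_).trans
    ((measure_mul_le_mul_card_le_exp hS hind hmem hunif p hs a).trans
      (ENNReal.ofReal_le_ofReal (Real.exp_le_exp.2 ?_)))
  · intro ω hω
    rw [Set.mem_ofPred_eq] at hω ⊢
    exact mul_le_mul_of_nonpos_left hω (by linarith)
  · have h := mul_le_mul_of_nonneg_right hmean (show 0 ≤ ε / 3 - (ε / 3) ^ 2 by nlinarith)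
    nlinarith [mul_nonneg (sq_nonneg ε) ha,
      mul_nonneg (mul_nonneg (sq_nonneg ε) ha) (sub_nonneg.2 hε')]

/-- **Tail estimation guarantee.** For a sufficiently large constant `c > 0`, there is a
constant `c' > 0` such that: sampling `r ≥ c m ln n / (τ εD²)` edges i.i.d. uniformly,
setting `d̂(v) = (m/r)|{j : v ∈ eⱼ}|` and `Ĉ(d) = |{v : d̂(v) ≥ d}|`, with probability
at least `1 - n^{-c'}`, simultaneously every degree `d > τ` satisfies
`C((1+εD)d) ≤ Ĉ(d) ≤ C((1-εD)d)`. -/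
theorem ccdh_tail_estimation :
    ∃ c₀ : ℝ, 0 < c₀ ∧ ∀ c : ℝ, c₀ ≤ c → ∃ c' : ℝ, 0 < c' ∧
      ∀ (V : Type) [Fintype V] (G : SimpleGraph V) [DecidableRel G.Adj] (n m : ℕ),
        n = Fintype.card V → 2 ≤ n → m = G.edgeSet.ncard → 1 ≤ m →
      ∀ τ εD : ℝ, 1 ≤ τ → 0 < εD → εD ≤ 1 / 2 →
      ∀ (Ω : Type) [MeasurableSpace Ω] (μ : Measure Ω) [IsProbabilityMeasure μ]
        (r : ℕ) (e : Fin r → Ω → Sym2 V),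
        c * m * Real.log n / (τ * εD ^ 2) ≤ r →
        iIndepFun (m := fun _ => ⊤) e μ →
        (∀ j ω, e j ω ∈ G.edgeSet) →
        (∀ j : Fin r, ∀ ε' ∈ G.edgeSet, μ {ω | e j ω = ε'} = (m : ENNReal)⁻¹) →
      ∀ dhat : Ω → V → ℝ,
        (∀ ω w, dhat ω w = (m / r : ℝ) * ({j : Fin r | w ∈ e j ω}.ncard : ℝ)) →
      ∀ Chat : Ω → ℕ → ℕ,
        (∀ ω d, Chat ω d = {w : V | (d : ℝ) ≤ dhat ω w}.ncard) →
      1 - (n : ℝ) ^ (-c') ≤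
        (μ {ω | ∀ d : ℕ, τ < (d : ℝ) →
          (ccdhR G ((1 + εD) * d) : ℝ) ≤ (Chat ω d : ℝ) ∧
          (Chat ω d : ℝ) ≤ (ccdhR G ((1 - εD) * d) : ℝ)}).toReal := by
  classical
  refine ⟨18, by norm_num, fun c hc => ⟨c / 6 - 2, by linarith, ?_⟩⟩
  intro V _ G _ n m hn hn2 hm hm1 τ ε hτ hε hε' Ω _ μ _ r e hr hind hmem hunif dhat hdhat
    Chat hChat
  set S : Finset (Sym2 V) := G.edgeFinset with hSdef
  have hSm : S.card = m := by
    rw [hm, hSdef, ← SimpleGraph.coe_edgeFinset, Set.ncard_coe_finset]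
  have hS : S.Nonempty := Finset.card_pos.1 (by omega)
  have hmemS : ∀ j ω, e j ω ∈ S := fun j ω => SimpleGraph.mem_edgeFinset.2 (hmem j ω)
  have hunifS : ∀ j, ∀ a ∈ S, μ {ω | e j ω = a} = (S.card : ENNReal)⁻¹ := fun j a ha => by
    rw [hSm]; exact hunif j a (SimpleGraph.mem_edgeFinset.1 ha)
  have hdeg (v : V) : (S.filter (v ∈ ·)).card = G.degree v := by
    rw [hSdef, ← SimpleGraph.incidenceFinset_eq_filter, SimpleGraph.card_incidenceFinset_eq_degree]
  have hcount (ω : Ω) (v : V) :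
      {j : Fin r | v ∈ e j ω}.ncard = (Finset.univ.filter fun j => v ∈ e j ω).card := by
    rw [← Set.ncard_coe_finset]; simp
  have hm0 : (0 : ℝ) < m := by exact_mod_cast hm1
  have hn2' : (2 : ℝ) ≤ n := by exact_mod_cast hn2
  have hn0 : (0 : ℝ) < n := by linarith
  have hlog : 0 < Real.log n := Real.log_pos (by linarith)
  have hτ0 : 0 < τ := by linarith
  have hr0 : (0 : ℝ) < r := lt_of_lt_of_le (by positivity) hr
  have hbound (t : ℝ) (ht : τ ≤ t) :
      ENNReal.ofReal (Real.exp (-(ε ^ 2 * (r * t / m) / 6))) ≤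
        ENNReal.ofReal ((n : ℝ) ^ (-(c / 6))) := by
    refine ENNReal.ofReal_le_ofReal ?_
    rw [Real.rpow_def_of_pos hn0, Real.exp_le_exp]
    have h1 : c * m * Real.log n ≤ r * (τ * ε ^ 2) := (div_le_iff₀ (by positivity)).1 hr
    have h2 : r * (τ * ε ^ 2) ≤ r * (t * ε ^ 2) := by gcongr
    have h3 : c * Real.log n ≤ ε ^ 2 * (r * t / m) := by
      rw [← mul_div_assoc, le_div_iff₀ hm0]; linarith
    linarith
  set bad : V → Set Ω := fun v => {ω | ∃ d : ℕ, τ < d ∧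
    ((1 + ε) * d ≤ G.degree v ∧ dhat ω v < d ∨ (d : ℝ) ≤ dhat ω v ∧ G.degree v < (1 - ε) * d)}
  have hdhat_le (ω : Ω) (v : V) (d : ℝ) :
      d ≤ dhat ω v ↔ r * d / m ≤ (Finset.univ.filter fun j => v ∈ e j ω).card := by
    rw [hdhat, hcount, div_mul_eq_mul_div, le_div_iff₀ hr0, div_le_iff₀ hm0, mul_comm d,
      mul_comm (m : ℝ)]
  have hmeas (v : V) : μ (bad v) ≤ 2 * ENNReal.ofReal ((n : ℝ) ^ (-(c / 6))) := by
    set k : ℝ := (G.degree v : ℝ) with hk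
    have hupper : μ {ω | r * max τ (k / (1 - ε)) / m ≤
        (Finset.univ.filter fun j => v ∈ e j ω).card} ≤ ENNReal.ofReal ((n : ℝ) ^ (-(c / 6))) := by
      refine (measure_le_card_le_exp hS hind hmemS hunifS (v ∈ ·) hε hε' ?_ ?_).trans
        (hbound _ (le_max_left _ _))
      · have := le_max_left τ (k / (1 - ε))
        have := hτ0.trans_le this
        positivity
      · rw [hdeg, hSm, ← hk, ← mul_div_assoc]
        have h1 := (div_le_iff₀ (by linarith)).1 (le_max_right τ (k / (1 - ε)))
        rw [mul_left_comm, mul_comm (1 - ε)]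
        gcongr
    have hlower : μ {ω | τ ≤ k / (1 + ε) ∧
        ((Finset.univ.filter fun j => v ∈ e j ω).card : ℝ) ≤ r * (k / (1 + ε)) / m} ≤
          ENNReal.ofReal ((n : ℝ) ^ (-(c / 6))) := by
      by_cases hkτ : τ ≤ k / (1 + ε)
      · simp only [hkτ, true_and]
        refine (measure_card_le_le_exp hS hind hmemS hunifS (v ∈ ·) hε hε' (by positivity)
          (le_of_eq ?_)).trans (hbound _ hkτ)
        rw [hdeg, hSm, ← hk]
        field_simp
      · simp [hkτ]
    rw [two_mul]
    refine (measure_mono ?_).trans ((measure_union_le _ _).trans (add_le_add hupper hlower))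
    rintro ω ⟨d, hd, ⟨h1, h2⟩ | ⟨h1, h2⟩⟩
    · right
      have h3 : (d : ℝ) ≤ k / (1 + ε) := by rw [le_div_iff₀ (by linarith)]; linarith
      refine ⟨hd.le.trans h3, ?_⟩
      rw [← not_le, hdhat_le, not_le] at h2
      refine h2.le.trans ?_
      gcongr
    · left
      rw [hdhat_le] at h1
      refine le_trans ?_ h1
      have h3 : max τ (k / (1 - ε)) ≤ d :=
        max_le hd.le ((div_le_iff₀ (by linarith)).2 (by linarith))
      gcongr
  set good : Set Ω := {ω | ∀ d : ℕ, τ < (d : ℝ) →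
    (ccdhR G ((1 + ε) * d) : ℝ) ≤ (Chat ω d : ℝ) ∧
    (Chat ω d : ℝ) ≤ (ccdhR G ((1 - ε) * d) : ℝ)}
  have hcover : Set.univ ⊆ good ∪ ⋃ v ∈ (Finset.univ : Finset V), bad v := by
    intro ω _
    by_cases h : ∃ v, ω ∈ bad v
    · obtain ⟨v, hv⟩ := h
      exact Or.inr (Set.mem_biUnion (Finset.mem_univ v) hv)
    · left
      intro d hd
      rw [hChat, ccdhR, ccdhR]
      constructor
      · refine Nat.cast_le.2 (Set.ncard_le_ncard (fun v hv => ?_) (Set.toFinite _))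
        by_contra hlt
        exact h ⟨v, d, hd, Or.inl ⟨hv, not_le.1 hlt⟩⟩
      · refine Nat.cast_le.2 (Set.ncard_le_ncard (fun v hv => ?_) (Set.toFinite _))
        by_contra hlt
        exact h ⟨v, d, hd, Or.inr ⟨hv, not_le.1 hlt⟩⟩
  have hfail : (n : ℝ) * (2 * (n : ℝ) ^ (-(c / 6))) ≤ (n : ℝ) ^ (-(c / 6 - 2)) := by
    rw [show -(c / 6 - 2) = 2 + -(c / 6) by ring, Real.rpow_add hn0, Real.rpow_two, ← mul_assoc]
    gcongr
    nlinarith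
  have htotal : (1 : ENNReal) ≤ μ good + ENNReal.ofReal ((n : ℝ) ^ (-(c / 6 - 2))) := by
    calc (1 : ENNReal) = μ Set.univ := measure_univ.symm
      _ ≤ μ good + μ (⋃ v ∈ (Finset.univ : Finset V), bad v) :=
        (measure_mono hcover).trans (measure_union_le _ _)
      _ ≤ μ good + ∑ v : V, μ (bad v) := by gcongr; exact measure_biUnion_finset_le _ _
      _ ≤ μ good + ∑ v : V, 2 * ENNReal.ofReal ((n : ℝ) ^ (-(c / 6))) := by
        gcongr with v; exact hmeas v
      _ = μ good + ENNReal.ofReal (n * (2 * (n : ℝ) ^ (-(c / 6)))) := by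
        rw [Finset.sum_const, Finset.card_univ, ← hn, nsmul_eq_mul,
          ENNReal.ofReal_mul hn0.le, ENNReal.ofReal_mul (by norm_num), ENNReal.ofReal_natCast,
          ENNReal.ofReal_ofNat]
      _ ≤ _ := by gcongr
  have hreal := ENNReal.toReal_mono (by finiteness) htotal
  rw [ENNReal.toReal_add (by finiteness) (by finiteness), ENNReal.toReal_one,
    ENNReal.toReal_ofReal (by positivity)] at hreal
  linarith
end
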